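/- Let a_m = Π_{P | m} |P|/(|P|+1) and d_k the k-fold divisor function on monic polynomials in F_q[T]. Then as z → ∞, Σ_{m monic, deg m ≤ z} d_k(m²) a_m / |m| ∼ C(k) z^{k(k+1)/2} for some positive constant C(k). -/

import Mathlib

open Polynomial Filter Asymptotics
open scoped Classical

variable {Fq : Type} [Field Fq] [Fintype Fq]

/-- Norm of a polynomial: `|f| = q^(deg f)` for `f ≠ 0`, and `|0| = 0`. -/
noncomputable def pnorm (f : Polynomial Fq) : ℝ :=
  if f = 0 then 0 else (Fintype.card Fq : ℝ) ^ f.natDegree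

/-- Monic polynomials of degree `n`. -/
def monicDeg (Fq : Type) [Field Fq] (n : ℕ) : Set (Polynomial Fq) :=
  {f | f.Monic ∧ f.natDegree = n}

/-- `H_{2g+1}`: monic square-free polynomials of degree `2g+1`. -/
def Hset (Fq : Type) [Field Fq] (g : ℕ) : Set (Polynomial Fq) :=
  {D | D.Monic ∧ Squarefree D ∧ D.natDegree = 2 * g + 1}

/-- Quadratic residue symbol `(D/P)` for an irreducible `P`. -/
noncomputable def quadCharP (D P : Polynomial Fq) : ℤ :=
  if P ∣ D then 0 else if ∃ x : Polynomial Fq, P ∣ (x ^ 2 - D) then 1 else -1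

/-- Jacobi-type quadratic residue symbol `(D/n)`, extended multiplicatively over
irreducible factors of `n`. -/
noncomputable def jacobi (D n : Polynomial Fq) : ℤ :=
  ((UniqueFactorizationMonoid.factors n).map (quadCharP D)).prod

/-- The quadratic Dirichlet L-function `L(s, χ_D)` as a finite sum
`Σ_{n=0}^{deg D - 1} (Σ_{f monic, deg f = n} χ_D(f)) q^{-ns}`. -/
noncomputable def Lfun (D : Polynomial Fq) (s : ℂ) : ℂ :=
  ∑ n ∈ Finset.range D.natDegree,
    (∑ᶠ f ∈ monicDeg Fq n, (jacobi D f : ℂ)) * (Fintype.card Fq : ℂ) ^ (-(n : ℂ) * s)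

/-- The central value `L(1/2, χ_D)` as a real number. -/
noncomputable def LhalfR (D : Polynomial Fq) : ℝ :=
  ∑ n ∈ Finset.range D.natDegree,
    (∑ᶠ f ∈ monicDeg Fq n, (jacobi D f : ℝ)) * (Real.sqrt (Fintype.card Fq))⁻¹ ^ n

/-- `a_m = Π_{P | m} |P|/(|P|+1)` over monic irreducible divisors `P` of `m`. -/
noncomputable def am (m : Polynomial Fq) : ℝ :=
  ∏ᶠ (P : Polynomial Fq) (_ : P.Monic ∧ Irreducible P ∧ P ∣ m), pnorm P / (pnorm P + 1)

/-- `d_k(m)`: the number of ordered `k`-tuples of monic polynomials with product `m`. -/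
noncomputable def dfold (k : ℕ) (m : Polynomial Fq) : ℕ :=
  Nat.card {t : Fin k → Polynomial Fq // (∀ i, (t i).Monic) ∧ ∏ i, t i = m}

/-- Möbius function on `F_q[T]`. -/
noncomputable def moebiusP (f : Polynomial Fq) : ℤ :=
  if Squarefree f then (-1) ^ (UniqueFactorizationMonoid.factors f).card else 0

/-- The Dirichlet polynomial `A(D) = Σ_{n monic, deg n ≤ 4g/(15k)} χ_D(n)/√|n|`. -/
noncomputable def AD (k g : ℕ) (D : Polynomial Fq) : ℝ :=
  ∑ᶠ n ∈ {n : Polynomial Fq | n.Monic ∧ n.natDegree ≤ 4 * g / (15 * k)},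
    (jacobi D n : ℝ) / Real.sqrt (pnorm n)

section SeriesAnalysis

open scoped PowerSeries Topology

/-- Absolute summability of the coefficients of a real power series. -/
def AbsSummable (F : ℝ⟦X⟧) : Prop := Summable fun n => ‖PowerSeries.coeff n F‖

/-- The sum of the coefficients of a real power series. -/
noncomputable def coeffSum (F : ℝ⟦X⟧) : ℝ := ∑' n, PowerSeries.coeff n F

/-- The power series of absolute values of the coefficients. -/
noncomputable def absSeries (F : ℝ⟦X⟧) : ℝ⟦X⟧ := PowerSeries.mk fun n => |PowerSeries.coeff n F|

lemma absSummable_one : AbsSummable 1 :=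
  summable_of_ne_finset_zero (s := {0}) fun n hn => by
    simp only [Finset.mem_singleton] at hn
    simp [PowerSeries.coeff_one, hn]

lemma coeffSum_one : coeffSum 1 = 1 := by
  rw [coeffSum, tsum_eq_single 0 fun n hn => by simp [PowerSeries.coeff_one, hn]]
  simp

lemma AbsSummable.mul {F G : ℝ⟦X⟧} (hF : AbsSummable F) (hG : AbsSummable G) :
    AbsSummable (F * G) := by
  simpa only [AbsSummable, PowerSeries.coeff_mul] using
    summable_norm_sum_mul_antidiagonal_of_summable_norm hF hG

lemma coeffSum_mul {F G : ℝ⟦X⟧} (hF : AbsSummable F) (hG : AbsSummable G) :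
    coeffSum (F * G) = coeffSum F * coeffSum G := by
  simp only [coeffSum, PowerSeries.coeff_mul]
  exact (tsum_mul_tsum_eq_tsum_sum_antidiagonal_of_summable_norm hF hG).symm

lemma AbsSummable.prod {ι : Type*} {F : ι → ℝ⟦X⟧} (s : Finset ι) (hF : ∀ i, AbsSummable (F i)) :
    AbsSummable (∏ i ∈ s, F i) :=
  Finset.prod_induction F AbsSummable (fun _ _ => AbsSummable.mul) absSummable_one
    fun i _ => hF i

lemma AbsSummable.pow {F : ℝ⟦X⟧} (hF : AbsSummable F) (k : ℕ) : AbsSummable (F ^ k) := by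
  simpa using AbsSummable.prod (Finset.range k) fun _ => hF

lemma coeffSum_prod {ι : Type*} {F : ι → ℝ⟦X⟧} (s : Finset ι) (hF : ∀ i, AbsSummable (F i)) :
    coeffSum (∏ i ∈ s, F i) = ∏ i ∈ s, coeffSum (F i) := by
  induction s using Finset.induction_on with
  | empty => simp [coeffSum_one]
  | insert i s hi ih =>
    rw [Finset.prod_insert hi, Finset.prod_insert hi, coeffSum_mul (hF i) (.prod s hF), ih]

lemma coeffSum_pow {F : ℝ⟦X⟧} (hF : AbsSummable F) (k : ℕ) :
    coeffSum (F ^ k) = coeffSum F ^ k := by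
  simpa using coeffSum_prod (Finset.range k) fun _ => hF

lemma AbsSummable.absSeries {F : ℝ⟦X⟧} (hF : AbsSummable F) : AbsSummable (absSeries F) := by
  simpa [AbsSummable, _root_.absSeries] using hF

lemma expand_support {d : ℕ} (hd : d ≠ 0) (F : ℝ⟦X⟧) :
    Function.support (fun n => PowerSeries.coeff n (PowerSeries.expand d hd F)) ⊆
      Set.range fun n => d * n := by
  intro n hn
  by_contra h
  refine hn (PowerSeries.coeff_expand_of_not_dvd d hd F fun hdvd => h ?_)
  obtain ⟨m, rfl⟩ := hdvd
  exact ⟨m, rfl⟩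

lemma AbsSummable.expand {F : ℝ⟦X⟧} (hF : AbsSummable F) {d : ℕ} (hd : d ≠ 0) :
    AbsSummable (PowerSeries.expand d hd F) := by
  have hinj : Function.Injective fun n : ℕ => d * n := fun a b h =>
    Nat.eq_of_mul_eq_mul_left (Nat.pos_of_ne_zero hd) h
  refine (hinj.summable_iff fun n hn => ?_).mp ?_
  · rw [norm_eq_zero]
    by_contra h
    exact hn (expand_support hd F h)
  · simpa [Function.comp_def, AbsSummable] using hF

lemma coeffSum_expand (F : ℝ⟦X⟧) {d : ℕ} (hd : d ≠ 0) :
    coeffSum (PowerSeries.expand d hd F) = coeffSum F := by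
  have hinj : Function.Injective fun n : ℕ => d * n := fun a b h =>
    Nat.eq_of_mul_eq_mul_left (Nat.pos_of_ne_zero hd) h
  rw [coeffSum, ← hinj.tsum_eq (expand_support hd F)]
  simp [coeffSum]

lemma tsum_abs_coeff_expand (F : ℝ⟦X⟧) {d : ℕ} (hd : d ≠ 0) :
    ∑' n, |PowerSeries.coeff n (PowerSeries.expand d hd F)| = ∑' n, |PowerSeries.coeff n F| := by
  have hinj : Function.Injective fun n : ℕ => d * n := fun a b h =>
    Nat.eq_of_mul_eq_mul_left (Nat.pos_of_ne_zero hd) h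
  rw [← hinj.tsum_eq fun n hn => expand_support hd F fun h => hn (abs_eq_zero.2 h)]
  simp

lemma coeff_expand_eq_zero_of_lt {d : ℕ} (hd : d ≠ 0) (F : ℝ⟦X⟧) {n : ℕ} (hn : n ≠ 0)
    (hnd : n < d) : PowerSeries.coeff n (PowerSeries.expand d hd F) = 0 :=
  PowerSeries.coeff_expand_of_not_dvd d hd F fun h =>
    (Nat.le_of_dvd (Nat.pos_of_ne_zero hn) h).not_gt hnd

lemma abs_coeff_prod_le {ι : Type*} (F : ι → ℝ⟦X⟧) (s : Finset ι) (n : ℕ) :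
    |PowerSeries.coeff n (∏ i ∈ s, F i)| ≤ PowerSeries.coeff n (∏ i ∈ s, absSeries (F i)) := by
  rw [PowerSeries.coeff_prod, PowerSeries.coeff_prod]
  refine (Finset.abs_sum_le_sum_abs _ _).trans_eq ?_
  simp [Finset.abs_prod, absSeries]

lemma coeff_prod_absSeries_nonneg {ι : Type*} (F : ι → ℝ⟦X⟧) (s : Finset ι) (n : ℕ) :
    0 ≤ PowerSeries.coeff n (∏ i ∈ s, absSeries (F i)) :=
  (abs_nonneg _).trans (abs_coeff_prod_le F s n)

lemma coeff_zero_prod_eq_one {ι : Type*} {F : ι → ℝ⟦X⟧}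
    (h0 : ∀ i, PowerSeries.coeff 0 (F i) = 1) (s : Finset ι) :
    PowerSeries.coeff 0 (∏ i ∈ s, F i) = 1 := by
  simp only [PowerSeries.coeff_zero_eq_constantCoeff] at h0 ⊢
  simp [map_prod, h0]

lemma coeff_prod_absSeries_mono {ι : Type*} {F : ι → ℝ⟦X⟧}
    (h0 : ∀ i, PowerSeries.coeff 0 (F i) = 1)
    {s t : Finset ι} (hst : s ⊆ t) (n : ℕ) :
    PowerSeries.coeff n (∏ i ∈ s, absSeries (F i)) ≤
      PowerSeries.coeff n (∏ i ∈ t, absSeries (F i)) := by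
  rw [← Finset.prod_sdiff hst, PowerSeries.coeff_mul]
  have hmem : (0, n) ∈ Finset.HasAntidiagonal.antidiagonal n := by simp
  refine le_trans ?_ (Finset.single_le_sum (fun p _ => mul_nonneg
    (coeff_prod_absSeries_nonneg F _ _) (coeff_prod_absSeries_nonneg F _ _)) hmem)
  rw [coeff_zero_prod_eq_one fun i => by
    simp [absSeries, PowerSeries.coeff_mk, h0 i, -PowerSeries.coeff_zero_eq_constantCoeff]]
  simp

variable {ι : Type*} {deg : ι → ℕ} {s : ℕ → Finset ι}

/-- Factors that are `1` up to a degree exceeding `n` do not affect the `n`-th coefficient. -/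
lemma coeff_prod_stable (hs : ∀ i d, i ∈ s d ↔ deg i ≤ d) {F : ι → ℝ⟦X⟧}
    (h0 : ∀ i, PowerSeries.coeff 0 (F i) = 1)
    (hF : ∀ i n, n ≠ 0 → n < deg i → PowerSeries.coeff n (F i) = 0)
    {n d : ℕ} (hnd : n ≤ d) :
    PowerSeries.coeff n (∏ i ∈ s d, F i) = PowerSeries.coeff n (∏ i ∈ s n, F i) := by
  have hst : s n ⊆ s d := fun i hi => (hs i d).2 (((hs i n).1 hi).trans hnd)
  rw [← Finset.prod_sdiff hst, PowerSeries.coeff_mul, Finset.sum_eq_single (0, n)]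
  · rw [coeff_zero_prod_eq_one h0, one_mul]
  · rintro ⟨a, b⟩ hab hne
    rw [Finset.HasAntidiagonal.mem_antidiagonal] at hab
    have ha : a ≠ 0 := by
      rintro rfl
      exact hne (by simpa using hab)
    simp only at hab ⊢
    rw [PowerSeries.coeff_prod, Finset.sum_eq_zero, zero_mul]
    intro l hl
    rw [Finset.mem_finsuppAntidiag] at hl
    obtain ⟨i, hi, hli⟩ : ∃ i ∈ s d \ s n, l i ≠ 0 := by
      by_contra! h
      exact ha (by rw [← hl.1, Finset.sum_eq_zero h])
    refine Finset.prod_eq_zero hi (hF i _ hli ?_)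
    have h1 : l i ≤ a := hl.1 ▸ Finset.single_le_sum (fun _ _ => Nat.zero_le _) hi
    have h2 : ¬ deg i ≤ n := fun h => (Finset.mem_sdiff.1 hi).2 ((hs i n).2 h)
    omega
  · simp

/-- An infinite product of power series whose factors are summably close to `1` has absolutely
summable coefficients, and their sum does not vanish if no factor does. -/
theorem summable_coeffSum_ne_zero_of_prod (hs : ∀ i d, i ∈ s d ↔ deg i ≤ d) {F : ι → ℝ⟦X⟧}
    (h0 : ∀ i, PowerSeries.coeff 0 (F i) = 1)
    (hF : ∀ i n, n ≠ 0 → n < deg i → PowerSeries.coeff n (F i) = 0)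
    (hA : ∀ i, AbsSummable (F i)) {c : ι → ℝ} (hc : Summable c)
    (hFc : ∀ i, ∑' n, |PowerSeries.coeff n (F i - 1)| ≤ c i) (hne : ∀ i, coeffSum (F i) ≠ 0)
    {G : ℝ⟦X⟧} (hG : ∀ n, PowerSeries.coeff n G = PowerSeries.coeff n (∏ i ∈ s n, F i)) :
    AbsSummable G ∧ coeffSum G ≠ 0 := by
  have hA1 : ∀ i, Summable fun n => |PowerSeries.coeff n (F i - 1)| := fun i => by
    simpa [sub_eq_add_neg] using (((hA i).of_norm).add (absSummable_one.of_norm.neg)).norm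
  have hc0 : ∀ i, 0 ≤ c i := fun i => (tsum_nonneg fun n => abs_nonneg _).trans (hFc i)
  have habs : ∀ i, coeffSum (absSeries (F i)) ≤ 1 + c i := fun i => by
    rw [← coeffSum_one]
    refine le_trans ?_ (add_le_add_right (hFc i) _)
    rw [coeffSum, coeffSum, ← Summable.tsum_add absSummable_one.of_norm (hA1 i)]
    refine Summable.tsum_le_tsum (fun n => ?_) (hA i).absSeries.of_norm
      (absSummable_one.of_norm.add (hA1 i))
    have h1 : PowerSeries.coeff n (F i) =
        PowerSeries.coeff n 1 + PowerSeries.coeff n (F i - 1) := by simp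
    have h2 : |PowerSeries.coeff n (1 : ℝ⟦X⟧)| = PowerSeries.coeff n 1 := by
      rw [PowerSeries.coeff_one]
      split_ifs <;> simp
    rw [absSeries, PowerSeries.coeff_mk, h1]
    exact (abs_add_le _ _).trans (by rw [h2])
  set b : ℕ → ℝ := fun n => PowerSeries.coeff n (∏ i ∈ s n, absSeries (F i)) with hb
  have hstab : ∀ {n d}, n ≤ d → PowerSeries.coeff n (∏ i ∈ s d, absSeries (F i)) = b n := fun hnd =>
    coeff_prod_stable hs (fun i => by
      rw [absSeries, PowerSeries.coeff_mk, h0 i, abs_one]) (fun i n hn hlt => by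
      rw [absSeries, PowerSeries.coeff_mk, hF i n hn hlt, abs_zero]) hnd
  have hbs : Summable b := by
    refine summable_of_sum_range_le (c := Real.exp (∑' i, c i))
      (fun n => coeff_prod_absSeries_nonneg F _ _) fun N => ?_
    calc ∑ n ∈ Finset.range N, b n
        = ∑ n ∈ Finset.range N, PowerSeries.coeff n (∏ i ∈ s N, absSeries (F i)) :=
          Finset.sum_congr rfl fun n hn => (hstab (Finset.mem_range.1 hn).le).symm
      _ ≤ coeffSum (∏ i ∈ s N, absSeries (F i)) :=
          (AbsSummable.prod _ fun i => (hA i).absSeries).of_norm.sum_le_tsum _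
            fun n _ => coeff_prod_absSeries_nonneg F _ _
      _ = ∏ i ∈ s N, coeffSum (absSeries (F i)) := coeffSum_prod _ fun i => (hA i).absSeries
      _ ≤ ∏ i ∈ s N, Real.exp (c i) := by
          refine Finset.prod_le_prod (fun i _ => tsum_nonneg fun n => ?_) fun i _ =>
            (habs i).trans (by rw [add_comm]; exact Real.add_one_le_exp _)
          simp [absSeries]
      _ = Real.exp (∑ i ∈ s N, c i) := (Real.exp_sum _ _).symm
      _ ≤ _ := Real.exp_le_exp.2 (hc.sum_le_tsum _ fun i _ => hc0 i)
  have hGb : ∀ n, |PowerSeries.coeff n G| ≤ b n := fun n => by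
    rw [hG n]
    exact abs_coeff_prod_le F _ n
  have hlim : Tendsto (fun d => coeffSum (∏ i ∈ s d, F i)) atTop (𝓝 (coeffSum G)) := by
    refine tendsto_tsum_of_dominated_convergence hbs (fun n => ?_) (.of_forall fun d n => ?_)
    · refine tendsto_const_nhds.congr' ?_
      filter_upwards [eventually_ge_atTop n] with d hd
      rw [hG n, coeff_prod_stable hs h0 hF hd]
    · refine (abs_coeff_prod_le F _ n).trans ?_
      rcases le_total n d with h | h
      · exact (hstab h).le
      · exact coeff_prod_absSeries_mono h0
          (fun i hi => (hs i n).2 (((hs i d).1 hi).trans h)) n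
  refine ⟨hbs.of_nonneg_of_le (fun _ => norm_nonneg _) hGb, ?_⟩
  have hsum : Summable fun i => ‖coeffSum (F i) - 1‖ := by
    refine hc.of_nonneg_of_le (fun _ => norm_nonneg _) fun i => le_trans ?_ (hFc i)
    have h1 : coeffSum (F i) - 1 = ∑' n, PowerSeries.coeff n (F i - 1) := by
      simp only [map_sub]
      rw [Summable.tsum_sub (hA i).of_norm absSummable_one.of_norm]
      exact congrArg (coeffSum (F i) - ·) coeffSum_one.symm
    rw [h1]
    exact norm_tsum_le_tsum_norm (hA1 i)
  have hprod := (multipliable_one_add_of_summable hsum).hasProd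
  have hsat : Tendsto s atTop atTop := by
    refine tendsto_atTop_finset_of_monotone (fun a b hab i hi =>
      (hs i b).2 (((hs i a).1 hi).trans hab)) fun i => ⟨deg i, (hs i _).2 le_rfl⟩
  have hlim' := hprod.comp hsat
  simp only [Function.comp_def, add_sub_cancel] at hlim'
  simp only [coeffSum_prod _ hA] at hlim
  rw [tendsto_nhds_unique hlim hlim']
  have := tprod_one_add_ne_zero_of_summable (f := fun i => coeffSum (F i) - 1)
    (fun i => by rw [add_sub_cancel]; exact hne i) hsum
  simp only [add_sub_cancel] at this
  exact this

end SeriesAnalysis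

section LocalFactor

open scoped PowerSeries

/-- The series `∑ j, d_k(P ^ (2 * j)) X ^ j`, which does not depend on the prime `P`. -/
noncomputable def squareSeries (k : ℕ) : ℝ⟦X⟧ :=
  PowerSeries.mk fun j => (k.multichoose (2 * j) : ℝ)

lemma AbsSummable.add {F G : ℝ⟦X⟧} (hF : AbsSummable F) (hG : AbsSummable G) :
    AbsSummable (F + G) := by
  simpa [AbsSummable] using (hF.of_norm.add hG.of_norm).norm

lemma AbsSummable.neg {F : ℝ⟦X⟧} (hF : AbsSummable F) : AbsSummable (-F) := by
  simpa [AbsSummable] using hF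

lemma AbsSummable.sub {F G : ℝ⟦X⟧} (hF : AbsSummable F) (hG : AbsSummable G) :
    AbsSummable (F - G) := by
  simpa [sub_eq_add_neg] using hF.add hG.neg

lemma AbsSummable.C_mul {F : ℝ⟦X⟧} (hF : AbsSummable F) (b : ℝ) :
    AbsSummable (PowerSeries.C b * F) := by
  simpa [AbsSummable] using Summable.mul_left |b| hF

lemma rescale_one_sub_X (x : ℝ) : PowerSeries.rescale x (1 - PowerSeries.X : ℝ⟦X⟧) =
    1 - PowerSeries.C x * PowerSeries.X := by
  rw [map_sub, map_one, PowerSeries.rescale_X]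

lemma coeff_one_sub_C_mul_X_of_two_le (x : ℝ) {n : ℕ} (hn : n ∉ Finset.range 2) :
    PowerSeries.coeff n (1 - PowerSeries.C x * PowerSeries.X : ℝ⟦X⟧) = 0 := by
  rw [Finset.mem_range] at hn
  simp [PowerSeries.coeff_one, PowerSeries.coeff_X, show n ≠ 0 by omega, show n ≠ 1 by omega]

lemma absSummable_rescale_one_sub_X (x : ℝ) :
    AbsSummable (PowerSeries.rescale x (1 - PowerSeries.X : ℝ⟦X⟧)) := by
  rw [rescale_one_sub_X]
  exact summable_of_ne_finset_zero (s := Finset.range 2) fun n hn => by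
    rw [coeff_one_sub_C_mul_X_of_two_le x hn, norm_zero]

lemma coeffSum_rescale_one_sub_X (x : ℝ) :
    coeffSum (PowerSeries.rescale x (1 - PowerSeries.X : ℝ⟦X⟧)) = 1 - x := by
  rw [rescale_one_sub_X, coeffSum,
    tsum_eq_sum fun n hn => coeff_one_sub_C_mul_X_of_two_le x hn]
  simp [Finset.sum_range_succ, PowerSeries.coeff_one, sub_eq_add_neg]

lemma absSummable_rescale_squareSeries (k : ℕ) (hk : 0 < k) :
    AbsSummable (PowerSeries.rescale (1 / 2 : ℝ) (squareSeries k)) := by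
  obtain ⟨k, rfl⟩ := Nat.exists_eq_succ_of_ne_zero hk.ne'
  have hr : ‖√(1 / 2 : ℝ)‖ < 1 := by
    rw [Real.norm_of_nonneg (Real.sqrt_nonneg _), Real.sqrt_lt' one_pos]
    norm_num
  have hinj : Function.Injective fun j : ℕ => 2 * j := fun a b h => by simpa using h
  refine ((summable_choose_mul_geometric_of_norm_lt_one k hr).comp_injective hinj).congr fun j => ?_
  rw [Function.comp_apply, PowerSeries.coeff_rescale, squareSeries, PowerSeries.coeff_mk,
    Real.norm_of_nonneg (by positivity), Nat.multichoose_eq, pow_mul,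
    Real.sq_sqrt (by norm_num), mul_comm, show k.succ + 2 * j - 1 = 2 * j + k by omega,
    Nat.choose_symm_add]

lemma abs_coeff_rescale_le {W : ℝ⟦X⟧} {r : ℕ} (hr : ∀ j < r, PowerSeries.coeff j W = 0) {x : ℝ}
    (hx0 : 0 ≤ x) (hx : x ≤ 1 / 2) (j : ℕ) : |PowerSeries.coeff j (PowerSeries.rescale x W)| ≤
      (2 * x) ^ r * |PowerSeries.coeff j (PowerSeries.rescale (1 / 2 : ℝ) W)| := by
  rcases lt_or_ge j r with hj | hj
  · simp [PowerSeries.coeff_rescale, hr j hj]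
  · have h : x ^ j ≤ (2 * x) ^ r * (1 / 2) ^ j := by
      calc x ^ j = (2 * x) ^ j * (1 / 2) ^ j := by rw [← mul_pow]; ring
        _ ≤ _ := by
          gcongr ?_ * _
          exact pow_le_pow_of_le_one (by linarith) (by linarith) hj
    rw [PowerSeries.coeff_rescale, PowerSeries.coeff_rescale, abs_mul, abs_mul,
      abs_of_nonneg (pow_nonneg hx0 j), abs_of_nonneg (by positivity : (0 : ℝ) ≤ (1 / 2) ^ j),
      ← mul_assoc]
    gcongr

lemma AbsSummable.rescale_of_le_half {W : ℝ⟦X⟧}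
    (hW : AbsSummable (PowerSeries.rescale (1 / 2 : ℝ) W)) {x : ℝ}
    (hx0 : 0 ≤ x) (hx : x ≤ 1 / 2) : AbsSummable (PowerSeries.rescale x W) :=
  Summable.of_nonneg_of_le (fun _ => norm_nonneg _)
    (abs_coeff_rescale_le (r := 0) (fun _ h => absurd h (Nat.not_lt_zero _)) hx0 hx)
    (Summable.mul_left _ hW)

lemma tsum_abs_coeff_rescale_le {W : ℝ⟦X⟧}
    (hW : AbsSummable (PowerSeries.rescale (1 / 2 : ℝ) W))
    {r : ℕ} (hr : ∀ j < r, PowerSeries.coeff j W = 0) {x : ℝ} (hx0 : 0 ≤ x) (hx : x ≤ 1 / 2) :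
    ∑' j, |PowerSeries.coeff j (PowerSeries.rescale x W)| ≤
      (2 * x) ^ r * ∑' j, |PowerSeries.coeff j (PowerSeries.rescale (1 / 2 : ℝ) W)| := by
  rw [← tsum_mul_left]
  exact Summable.tsum_le_tsum (abs_coeff_rescale_le hr hx0 hx) (hW.rescale_of_le_half hx0 hx)
    (Summable.mul_left _ hW)

/-- The local factor `1 + (1 - b) * ∑ j ≥ 1, d_k(P ^ (2 * j)) X ^ j`. -/
noncomputable def localFactor (k : ℕ) (b : ℝ) : ℝ⟦X⟧ :=
  1 + PowerSeries.C (1 - b) * (squareSeries k - 1)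

lemma constantCoeff_squareSeries (k : ℕ) : PowerSeries.constantCoeff (squareSeries k) = 1 := by
  rw [← PowerSeries.coeff_zero_eq_constantCoeff_apply]
  simp [squareSeries, -PowerSeries.coeff_zero_eq_constantCoeff]

lemma coeff_one_squareSeries (k : ℕ) :
    PowerSeries.coeff 1 (squareSeries k) = (k * (k + 1) / 2 : ℕ) := by
  rw [squareSeries, PowerSeries.coeff_mk, mul_one, Nat.multichoose_eq, Nat.choose_two_right,
    mul_comm]
  simp

lemma coeff_localFactor (k : ℕ) (b : ℝ) (j : ℕ) : PowerSeries.coeff j (localFactor k b) =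
    if j = 0 then 1 else (1 - b) * k.multichoose (2 * j) := by
  rcases eq_or_ne j 0 with rfl | hj
  · simp [localFactor, constantCoeff_squareSeries]
  · rw [localFactor, map_add, PowerSeries.coeff_C_mul, map_sub]
    simp [squareSeries, PowerSeries.coeff_one, hj]

/-- The local factor, multiplied by the power of `1 - X` that removes its linear term. -/
noncomputable def reducedFactor (k : ℕ) (b : ℝ) : ℝ⟦X⟧ :=
  localFactor k b * (1 - PowerSeries.X) ^ (k * (k + 1) / 2)

lemma constantCoeff_reducedFactor (k : ℕ) (b : ℝ) :
    PowerSeries.constantCoeff (reducedFactor k b) = 1 := by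
  simp [reducedFactor, localFactor, constantCoeff_squareSeries]

lemma absSummable_rescale_localFactor {k : ℕ} (hk : 0 < k) (b : ℝ) :
    AbsSummable (PowerSeries.rescale (1 / 2 : ℝ) (localFactor k b)) := by
  have hC : PowerSeries.rescale (1 / 2 : ℝ) (PowerSeries.C (1 - b)) = PowerSeries.C (1 - b) := by
    ext j
    rw [PowerSeries.coeff_rescale, PowerSeries.coeff_C]
    split_ifs with hj <;> simp [hj]
  rw [localFactor, map_add, map_mul, hC, map_sub (PowerSeries.rescale _), map_one]
  exact absSummable_one.add (((absSummable_rescale_squareSeries k hk).sub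
    absSummable_one).C_mul (1 - b))

lemma rescale_reducedFactor (k : ℕ) (b x : ℝ) : PowerSeries.rescale x (reducedFactor k b) =
    PowerSeries.rescale x (localFactor k b) *
      PowerSeries.rescale x (1 - PowerSeries.X) ^ (k * (k + 1) / 2) := by
  rw [reducedFactor, map_mul, map_pow]

lemma absSummable_rescale_reducedFactor {k : ℕ} (hk : 0 < k) (b : ℝ) {x : ℝ} (hx0 : 0 ≤ x)
    (hx : x ≤ 1 / 2) : AbsSummable (PowerSeries.rescale x (reducedFactor k b)) := by
  rw [rescale_reducedFactor]
  exact ((absSummable_rescale_localFactor hk b).rescale_of_le_half hx0 hx).mul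
    ((absSummable_rescale_one_sub_X x).pow _)

lemma coeffSum_rescale_reducedFactor_ne_zero {k : ℕ} (hk : 0 < k) {b x : ℝ} (hb : b ≤ 1)
    (hx0 : 0 ≤ x) (hx : x ≤ 1 / 2) :
    coeffSum (PowerSeries.rescale x (reducedFactor k b)) ≠ 0 := by
  have hloc := (absSummable_rescale_localFactor hk b).rescale_of_le_half hx0 hx
  rw [rescale_reducedFactor, coeffSum_mul hloc ((absSummable_rescale_one_sub_X x).pow _),
    coeffSum_pow (absSummable_rescale_one_sub_X x), coeffSum_rescale_one_sub_X]
  refine mul_ne_zero (ne_of_gt ?_) (pow_ne_zero _ (by linarith))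
  have hnonneg : ∀ j, 0 ≤ PowerSeries.coeff j (PowerSeries.rescale x (localFactor k b)) := by
    intro j
    rw [PowerSeries.coeff_rescale, coeff_localFactor]
    have : 0 ≤ 1 - b := by linarith
    split_ifs <;> positivity
  refine hloc.of_norm.tsum_pos hnonneg 0 ?_
  rw [PowerSeries.coeff_rescale, coeff_localFactor]
  simp

/-- The reduced local factor at `x` differs from `1` by `O(x ^ 2)`. -/
lemma exists_tsum_abs_reducedFactor_sub_one_le {k : ℕ} (hk : 0 < k) :
    ∃ c : ℝ, ∀ b x : ℝ, 0 ≤ b → b ≤ x → x ≤ 1 / 2 →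
      ∑' j, |PowerSeries.coeff j (PowerSeries.rescale x (reducedFactor k b) - 1)| ≤
        c * x ^ 2 := by
  set T : ℝ⟦X⟧ := (1 - PowerSeries.X) ^ (k * (k + 1) / 2) with hT
  set U : ℝ⟦X⟧ := squareSeries k * T - 1 with hU
  set V : ℝ⟦X⟧ := (squareSeries k - 1) * T with hV
  have hTs : AbsSummable (PowerSeries.rescale (1 / 2 : ℝ) T) := by
    rw [hT, map_pow]
    exact (absSummable_rescale_one_sub_X _).pow _
  have hEs := absSummable_rescale_squareSeries k hk
  have hUs : AbsSummable (PowerSeries.rescale (1 / 2 : ℝ) U) := by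
    rw [hU, map_sub, map_mul, map_one]
    exact (hEs.mul hTs).sub absSummable_one
  have hVs : AbsSummable (PowerSeries.rescale (1 / 2 : ℝ) V) := by
    rw [hV, map_mul, map_sub, map_one]
    exact (hEs.sub absSummable_one).mul hTs
  have hU0 : ∀ j < 2, PowerSeries.coeff j U = 0 := by
    intro j hj
    interval_cases j
    · simp [hU, hT, constantCoeff_squareSeries]
    · rw [hU, map_sub, PowerSeries.coeff_one_mul, coeff_one_squareSeries, hT,
        PowerSeries.coeff_one_pow, constantCoeff_squareSeries]
      simp [PowerSeries.coeff_one, PowerSeries.coeff_one_X]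
  have hV0 : ∀ j < 1, PowerSeries.coeff j V = 0 := by
    intro j hj
    interval_cases j
    simp [hV, constantCoeff_squareSeries]
  refine ⟨4 * ∑' j, |PowerSeries.coeff j (PowerSeries.rescale (1 / 2 : ℝ) U)| +
    2 * ∑' j, |PowerSeries.coeff j (PowerSeries.rescale (1 / 2 : ℝ) V)|, fun b x hb hbx hx => ?_⟩
  have hx0 : 0 ≤ x := hb.trans hbx
  have hdecomp : reducedFactor k b - 1 = U - PowerSeries.C b * V := by
    simp only [reducedFactor, localFactor, hU, hV, map_sub, map_one]
    ring
  have hcoeff : ∀ j, |PowerSeries.coeff j (PowerSeries.rescale x (reducedFactor k b) - 1)| ≤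
      |PowerSeries.coeff j (PowerSeries.rescale x U)| +
        b * |PowerSeries.coeff j (PowerSeries.rescale x V)| := by
    intro j
    have h : PowerSeries.rescale x (reducedFactor k b) - 1 =
        PowerSeries.rescale x (U - PowerSeries.C b * V) := by rw [← hdecomp, map_sub, map_one]
    rw [h, map_sub, map_sub]
    refine (abs_sub _ _).trans_eq ?_
    simp only [PowerSeries.coeff_rescale, PowerSeries.coeff_C_mul, abs_mul, abs_of_nonneg hb]
    ring
  have hUx := hUs.rescale_of_le_half hx0 hx
  have hVx := (hVs.rescale_of_le_half hx0 hx).mul_left b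
  have hsum := Summable.add hUx hVx
  calc _ ≤ ∑' j, (|PowerSeries.coeff j (PowerSeries.rescale x U)| +
        b * |PowerSeries.coeff j (PowerSeries.rescale x V)|) :=
        Summable.tsum_le_tsum hcoeff
          (Summable.of_nonneg_of_le (fun _ => abs_nonneg _) hcoeff hsum) hsum
    _ = ∑' j, |PowerSeries.coeff j (PowerSeries.rescale x U)| +
        b * ∑' j, |PowerSeries.coeff j (PowerSeries.rescale x V)| := by
        rw [← tsum_mul_left]
        exact Summable.tsum_add hUx hVx
    _ ≤ (2 * x) ^ 2 * ∑' j, |PowerSeries.coeff j (PowerSeries.rescale (1 / 2 : ℝ) U)| +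
        x * ((2 * x) ^ 1 * ∑' j, |PowerSeries.coeff j (PowerSeries.rescale (1 / 2 : ℝ) V)|) := by
        gcongr
        · exact tsum_abs_coeff_rescale_le hUs hU0 hx0 hx
        · exact tsum_abs_coeff_rescale_le hVs hV0 hx0 hx
    _ = _ := by ring

end LocalFactor

section MonicFactorization

open UniqueFactorizationMonoid

variable {K : Type} [Field K]

variable (K) in
/-- The monic irreducible polynomials. -/
abbrev MonicPrime : Type := {P : K[X] // P.Monic ∧ Irreducible P}

/-- The monic polynomial with prescribed exponents of its monic irreducible factors. -/
noncomputable def ofExponents (l : MonicPrime K →₀ ℕ) : K[X] :=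
  l.prod fun P n => P.1 ^ n

lemma ofExponents_monic (l : MonicPrime K →₀ ℕ) : (ofExponents l).Monic :=
  monic_prod_of_monic _ _ fun P _ => P.2.1.pow _

lemma ofExponents_eq_prod_map (l : MonicPrime K →₀ ℕ) :
    ofExponents l = (l.toMultiset.map Subtype.val).prod := by
  rw [Finsupp.toMultiset_map, Finsupp.prod_toMultiset,
    Finsupp.prod_mapDomain_index (fun _ => pow_zero _) fun _ _ _ => pow_add _ _ _]
  rfl

lemma ofExponents_injective : Function.Injective (ofExponents (K := K)) := by
  intro l l' h
  rw [ofExponents_eq_prod_map, ofExponents_eq_prod_map] at h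
  have key : ∀ s : Multiset (MonicPrime K),
      normalizedFactors (s.map Subtype.val).prod = s.map Subtype.val := fun s => by
    rw [normalizedFactors_prod_eq _ fun a ha => ?_, Multiset.map_map]
    · exact Multiset.map_congr rfl fun P _ => P.2.1.normalize_eq_self
    · obtain ⟨P, _, rfl⟩ := Multiset.mem_map.1 ha
      exact P.2.2
  have h' := congrArg normalizedFactors h
  rw [key, key] at h'
  exact Multiset.toFinsupp.symm.injective (Multiset.map_injective Subtype.val_injective h')

lemma exists_ofExponents_eq {m : K[X]} (hm : m.Monic) : ∃ l, ofExponents l = m := by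
  have hprime : ∀ P ∈ normalizedFactors m, P.Monic ∧ Irreducible P := fun P hP =>
    ⟨((Polynomial.mem_normalizedFactors_iff hm.ne_zero).1 hP).2.1,
      irreducible_of_normalized_factor P hP⟩
  lift normalizedFactors m to Multiset (MonicPrime K) using hprime with s hs
  refine ⟨Multiset.toFinsupp s, ?_⟩
  rw [ofExponents_eq_prod_map, Multiset.toFinsupp_toMultiset, hs,
    prod_normalizedFactors_eq hm.ne_zero,
    hm.normalize_eq_self]

lemma ofExponents_add (l l' : MonicPrime K →₀ ℕ) :
    ofExponents (l + l') = ofExponents l * ofExponents l' :=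
  Finsupp.prod_add_index' (fun _ => pow_zero _) fun _ _ _ => pow_add _ _ _

lemma ofExponents_sum {ι : Type*} (s : Finset ι) (l : ι → MonicPrime K →₀ ℕ) :
    ofExponents (∑ i ∈ s, l i) = ∏ i ∈ s, ofExponents (l i) := by
  induction s using Finset.induction_on with
  | empty => simp [ofExponents]
  | insert i s hi ih => rw [Finset.sum_insert hi, Finset.prod_insert hi, ofExponents_add, ih]

lemma natDegree_ofExponents (l : MonicPrime K →₀ ℕ) :
    (ofExponents l).natDegree = l.sum fun P n => n * P.1.natDegree := by
  rw [ofExponents, Finsupp.prod, natDegree_prod_of_monic _ _ fun P _ => P.2.1.pow _]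
  simp [Finsupp.sum]

lemma dvd_ofExponents_iff (P : MonicPrime K) (l : MonicPrime K →₀ ℕ) :
    P.1 ∣ ofExponents l ↔ l P ≠ 0 := by
  constructor
  · intro h
    obtain ⟨Q, hQ, hPQ⟩ := (P.2.2.prime.dvd_finsetProd_iff _).1 h
    have hPQ' : P = Q := Subtype.ext <| eq_of_monic_of_associated P.2.1 Q.2.1 <|
      P.2.2.associated_of_dvd Q.2.2 (P.2.2.prime.dvd_of_dvd_pow hPQ)
    exact hPQ' ▸ Finsupp.mem_support_iff.1 hQ
  · intro h
    exact (dvd_pow_self _ h).trans (Finset.dvd_prod_of_mem _ (Finsupp.mem_support_iff.2 h))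

lemma MonicPrime.natDegree_ne_zero (P : MonicPrime K) : P.1.natDegree ≠ 0 :=
  P.2.2.natDegree_pos.ne'

/-- The number of `k`-tuples of natural numbers with sum `n`. -/
lemma card_fun_sum_eq (k n : ℕ) :
    Nat.card {f : Fin k → ℕ // ∑ i, f i = n} = k.multichoose n := by
  rw [← Nat.card_congr (Sym.equivNatSumOfFintype (Fin k) n), Nat.card_eq_fintype_card,
    Sym.card_sym_eq_multichoose, Fintype.card_fin]

/-- Tuples of exponent vectors with sum `l` are families of tuples of exponents. -/
noncomputable def sumExponentsEquiv {ι : Type*} (k : ℕ) (l : ι →₀ ℕ) :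
    {L : Fin k → ι →₀ ℕ // ∑ i, L i = l} ≃
      ∀ P : l.support, {f : Fin k → ℕ // ∑ i, f i = l P} where
  toFun L P := ⟨fun i => L.1 i P, by
    simpa only [Finsupp.finsetSum_apply] using DFunLike.congr_fun L.2 P.1⟩
  invFun g := ⟨fun i => Finsupp.onFinset l.support
      (fun P => if h : P ∈ l.support then (g ⟨P, h⟩).1 i else 0) fun P h => by
        by_contra h'
        exact h (dif_neg h'), by
    ext P
    rw [Finsupp.finsetSum_apply]
    by_cases h : P ∈ l.support
    · simp only [Finsupp.onFinset_apply, dif_pos h]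
      exact (g ⟨P, h⟩).2
    · simp only [Finsupp.onFinset_apply, dif_neg h, Finset.sum_const_zero]
      exact (Finsupp.notMem_support_iff.1 h).symm⟩
  left_inv L := by
    ext i P
    by_cases h : P ∈ l.support
    · simp only [Finsupp.onFinset_apply, dif_pos h]
    · have h' : ∑ j, L.1 j P = 0 := by
        rw [← Finsupp.finsetSum_apply, L.2, Finsupp.notMem_support_iff.1 h]
      simp only [Finsupp.onFinset_apply, dif_neg h]
      exact ((Finset.sum_eq_zero_iff.1 h') i (Finset.mem_univ i)).symm
  right_inv g := by
    ext P i
    simp only [Finsupp.onFinset_apply, dif_pos P.2]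

lemma dfold_ofExponents (k : ℕ) (l : MonicPrime K →₀ ℕ) :
    dfold k (ofExponents l) = l.prod fun _ n => k.multichoose n := by
  have hbij : Function.Bijective fun L : {L : Fin k → MonicPrime K →₀ ℕ // ∑ i, L i = l} =>
      (⟨fun i => ofExponents (L.1 i), fun i => ofExponents_monic _, by
        rw [← ofExponents_sum, L.2]⟩ :
        {t : Fin k → K[X] // (∀ i, (t i).Monic) ∧ ∏ i, t i = ofExponents l}) := by
    constructor
    · intro L L' h
      ext1
      funext i
      exact ofExponents_injective (congrFun (congrArg Subtype.val h) i)
    · rintro ⟨t, ht, htl⟩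
      choose L hL using fun i => exists_ofExponents_eq (ht i)
      refine ⟨⟨L, ofExponents_injective ?_⟩, ?_⟩
      · rw [ofExponents_sum, ← htl]
        exact Finset.prod_congr rfl fun i _ => hL i
      · ext1
        exact funext hL
  rw [dfold, ← Nat.card_congr (Equiv.ofBijective _ hbij),
    Nat.card_congr (sumExponentsEquiv k l), Nat.card_pi]
  simp only [card_fun_sum_eq]
  rw [Finset.prod_coe_sort l.support fun P => k.multichoose (l P)]
  rfl

lemma dfold_sq_ofExponents (k : ℕ) (l : MonicPrime K →₀ ℕ) :
    dfold k (ofExponents l ^ 2) = l.prod fun _ n => k.multichoose (2 * n) := by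
  have hsub : (l + l).support ⊆ l.support := fun P hP => by
    rw [Finsupp.mem_support_iff] at hP ⊢
    exact fun h => hP (by simp [h])
  rw [sq, ← ofExponents_add, dfold_ofExponents, Finsupp.prod_of_support_subset _ hsub _ (by simp)]
  exact Finset.prod_congr rfl fun P _ => by rw [Finsupp.add_apply, ← two_mul]

end MonicFactorization

section FiniteField

open scoped PowerSeries

lemma card_monicDeg (n : ℕ) : Nat.card (monicDeg Fq n) = Fintype.card Fq ^ n := by
  have hbij : Function.Bijective fun p : degreeLT Fq n =>
      (⟨X ^ n + p.1, monic_X_pow_add (mem_degreeLT.1 p.2), by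
        rw [natDegree_add_eq_left_of_degree_lt] <;> simp [mem_degreeLT.1 p.2]⟩ :
        monicDeg Fq n) := by
    constructor
    · intro p p' h
      exact Subtype.ext (add_left_cancel (congrArg Subtype.val h))
    · rintro ⟨f, hf, hfn⟩
      refine ⟨⟨f - X ^ n, mem_degreeLT.2 ?_⟩, by simp⟩
      have hdeg : f.degree = n := by rw [degree_eq_natDegree hf.ne_zero, hfn]
      rw [← hdeg]
      exact degree_sub_lt_left (by rw [hdeg, degree_X_pow]) hf.ne_zero (by simp [hf.leadingCoeff])
  rw [← Nat.card_congr (Equiv.ofBijective _ hbij),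
    Nat.card_congr (degreeLTEquiv Fq n).toEquiv, Nat.card_fun]
  simp

lemma finite_monicDeg (n : ℕ) : (monicDeg Fq n).Finite := by
  refine Nat.finite_of_card_ne_zero ?_
  rw [card_monicDeg]
  exact pow_ne_zero _ Fintype.card_ne_zero

lemma pnorm_ofExponents (l : MonicPrime Fq →₀ ℕ) :
    pnorm (ofExponents l) = l.prod fun P n => pnorm P.1 ^ n := by
  rw [pnorm, if_neg (ofExponents_monic l).ne_zero, natDegree_ofExponents, Finsupp.sum,
    ← Finset.prod_pow_eq_pow_sum]
  refine Finset.prod_congr rfl fun P _ => ?_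
  simp only [pnorm, if_neg P.2.1.ne_zero]
  rw [← pow_mul, mul_comm]

lemma am_ofExponents (l : MonicPrime Fq →₀ ℕ) :
    am (ofExponents l) = l.prod fun P _ => pnorm P.1 / (pnorm P.1 + 1) := by
  have hset : {P : Polynomial Fq | P.Monic ∧ Irreducible P ∧ P ∣ ofExponents l} =
      Subtype.val '' (l.support : Set (MonicPrime Fq)) := by
    ext P
    constructor
    · rintro ⟨h1, h2, h3⟩
      exact ⟨⟨P, h1, h2⟩, by simpa using (dvd_ofExponents_iff ⟨P, h1, h2⟩ l).1 h3, rfl⟩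
    · rintro ⟨P, hP, rfl⟩
      exact ⟨P.2.1, P.2.2, (dvd_ofExponents_iff P l).2 (by simpa using hP)⟩
  calc am (ofExponents l) = ∏ᶠ P ∈ {P : Polynomial Fq | P.Monic ∧ Irreducible P ∧
        P ∣ ofExponents l}, pnorm P / (pnorm P + 1) := rfl
    _ = _ := by
      rw [hset, finprod_mem_image Subtype.val_injective.injOn, finprod_mem_coe_finset]
      rfl

lemma finite_monicPrime_natDegree_le (d : ℕ) :
    {P : MonicPrime Fq | P.1.natDegree ≤ d}.Finite := by
  have h : (⋃ n ∈ Finset.range (d + 1), monicDeg Fq n).Finite :=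
    Set.Finite.biUnion (Finset.finite_toSet _) fun n _ => finite_monicDeg n
  refine (h.preimage Subtype.val_injective.injOn).subset fun P hP => ?_
  simp only [Set.mem_preimage, Set.mem_iUnion]
  exact ⟨P.1.natDegree, Finset.mem_range.2 (Nat.lt_succ_of_le hP), P.2.1, rfl⟩

variable (Fq) in
/-- The monic irreducible polynomials of degree at most `d`. -/
noncomputable def primesLE (d : ℕ) : Finset (MonicPrime Fq) :=
  (finite_monicPrime_natDegree_le d).toFinset

lemma mem_primesLE (P : MonicPrime Fq) (d : ℕ) : P ∈ primesLE Fq d ↔ P.1.natDegree ≤ d := by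
  simp [primesLE]

/-- The Euler product of a multiplicative function, truncated at degree `d`. -/
theorem finsum_monicDeg_eq_coeff_prod {f : Polynomial Fq → ℝ} {W : MonicPrime Fq → ℝ⟦X⟧}
    (h0 : ∀ P, PowerSeries.coeff 0 (W P) = 1)
    (hf : ∀ l, f (ofExponents l) = l.prod fun P j => PowerSeries.coeff j (W P)) (n : ℕ) :
    ∑ᶠ m ∈ monicDeg Fq n, f m = PowerSeries.coeff n (∏ P ∈ primesLE Fq n,
      PowerSeries.expand P.1.natDegree P.natDegree_ne_zero (W P)) := by
  have hfin := (finite_monicDeg (Fq := Fq) n).preimage ofExponents_injective.injOn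
  have himage : monicDeg Fq n = ofExponents '' (hfin.toFinset : Set (MonicPrime Fq →₀ ℕ)) := by
    rw [Set.Finite.coe_toFinset, Set.image_preimage_eq_of_subset]
    rintro m ⟨hm, -⟩
    exact exists_ofExponents_eq hm
  let w : (MonicPrime Fq →₀ ℕ) → (MonicPrime Fq →₀ ℕ) := fun l =>
    Finsupp.onFinset l.support (fun P => P.1.natDegree * l P) fun P hP =>
      Finsupp.mem_support_iff.2 (right_ne_zero_of_mul hP)
  have hsupp : ∀ l, (ofExponents l).natDegree = n → l.support ⊆ primesLE Fq n := by
    intro l hl P hP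
    rw [mem_primesLE, ← hl, natDegree_ofExponents]
    refine le_trans ?_ (Finset.single_le_sum (f := fun P => l P * P.1.natDegree)
      (fun _ _ => Nat.zero_le _) hP)
    exact Nat.le_mul_of_pos_left _ (Nat.pos_of_ne_zero (Finsupp.mem_support_iff.1 hP))
  rw [himage, finsum_mem_image ofExponents_injective.injOn, finsum_mem_coe_finset,
    PowerSeries.coeff_prod]
  refine Finset.sum_of_injOn w ?_ ?_ ?_ ?_
  · intro l _ l' _ hll
    ext P
    exact Nat.eq_of_mul_eq_mul_left P.2.2.natDegree_pos (DFunLike.congr_fun hll P)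
  · intro l hl
    have hdeg : (ofExponents l).natDegree = n := by simpa [monicDeg, ofExponents_monic] using hl
    rw [Finset.mem_coe, Finset.mem_finsuppAntidiag]
    refine ⟨?_, Finsupp.support_onFinset_subset.trans (hsupp l hdeg)⟩
    have hsum := natDegree_ofExponents l
    rw [Finsupp.sum_of_support_subset _ (hsupp l hdeg) _ (by simp), hdeg] at hsum
    exact (Finset.sum_congr rfl fun P _ => mul_comm _ _).trans hsum.symm
  · intro l' hl' hnot
    rw [Finset.mem_finsuppAntidiag] at hl'
    by_contra hne
    rw [← ne_eq, Finset.prod_ne_zero_iff] at hne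
    have hdvd : ∀ P, P.1.natDegree ∣ l' P := fun P => by
      by_cases hP : P ∈ primesLE Fq n
      · by_contra hnd
        exact hne P hP (PowerSeries.coeff_expand_of_not_dvd _ _ _ hnd)
      · rw [Finsupp.notMem_support_iff.1 fun h => hP (hl'.2 h)]
        exact dvd_zero _
    let l : MonicPrime Fq →₀ ℕ := Finsupp.onFinset l'.support (fun P => l' P / P.1.natDegree)
      fun P hP => Finsupp.mem_support_iff.2 fun h => hP (by rw [h, Nat.zero_div])
    have hwl : w l = l' := by
      ext P
      exact Nat.mul_div_cancel' (hdvd P)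
    refine hnot ⟨l, ?_, hwl⟩
    have hls : l.support ⊆ primesLE Fq n := Finsupp.support_onFinset_subset.trans hl'.2
    have hdeg : (ofExponents l).natDegree = n := by
      rw [natDegree_ofExponents, Finsupp.sum_of_support_subset _ hls _ (by simp)]
      exact (Finset.sum_congr rfl fun P _ => Nat.div_mul_cancel (hdvd P)).trans hl'.1
    simpa [monicDeg, ofExponents_monic] using hdeg
  · intro l hl
    have hdeg : (ofExponents l).natDegree = n := by simpa [monicDeg, ofExponents_monic] using hl
    rw [hf, Finsupp.prod_of_support_subset _ (hsupp l hdeg) _ fun P _ => h0 P]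
    refine Finset.prod_congr rfl fun P _ => ?_
    simp [w]

lemma pnorm_of_monic {m : Polynomial Fq} (hm : m.Monic) :
    pnorm m = (Fintype.card Fq : ℝ) ^ m.natDegree := if_neg hm.ne_zero

lemma MonicPrime.two_le_pnorm (P : MonicPrime Fq) : 2 ≤ pnorm P.1 := by
  have hq : (2 : ℝ) ≤ Fintype.card Fq := by exact_mod_cast Fintype.one_lt_card (α := Fq)
  rw [pnorm_of_monic P.2.1]
  exact hq.trans (le_self_pow₀ (by linarith) P.natDegree_ne_zero)

lemma MonicPrime.inv_pnorm_nonneg (P : MonicPrime Fq) : 0 ≤ (pnorm P.1)⁻¹ :=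
  inv_nonneg.2 (zero_le_two.trans P.two_le_pnorm)

lemma MonicPrime.inv_pnorm_le_half (P : MonicPrime Fq) : (pnorm P.1)⁻¹ ≤ 1 / 2 := by
  rw [one_div]
  exact inv_anti₀ two_pos P.two_le_pnorm

lemma summable_inv_pnorm_sq : Summable fun P : MonicPrime Fq => (pnorm P.1)⁻¹ ^ 2 := by
  have hq : (2 : ℝ) ≤ Fintype.card Fq := by exact_mod_cast Fintype.one_lt_card (α := Fq)
  have hgeom : Summable fun n : ℕ => ((Fintype.card Fq : ℝ)⁻¹) ^ n :=
    summable_geometric_of_lt_one (by positivity) (inv_lt_one_of_one_lt₀ (by linarith))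
  refine summable_of_sum_le (c := ∑' n : ℕ, ((Fintype.card Fq : ℝ)⁻¹) ^ n)
    (fun P => sq_nonneg _) fun u => ?_
  rw [← Finset.sum_fiberwise_of_maps_to (t := u.image fun P => P.1.natDegree)
    (g := fun P => P.1.natDegree) fun P hP => Finset.mem_image_of_mem _ hP]
  refine le_trans (Finset.sum_le_sum fun n _ => ?_)
    (hgeom.sum_le_tsum _ fun n _ => by positivity)
  have hcard : (u.filter fun P => P.1.natDegree = n).card ≤ Fintype.card Fq ^ n := by
    rw [← card_monicDeg, Nat.card_eq_card_finite_toFinset (finite_monicDeg n)]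
    refine Finset.card_le_card_of_injOn Subtype.val (fun P hP => ?_) Subtype.val_injective.injOn
    simpa [monicDeg, P.2.1] using (Finset.mem_filter.1 hP).2
  have hterm : ∀ P ∈ u.filter fun P => P.1.natDegree = n,
      (pnorm P.1)⁻¹ ^ 2 = ((Fintype.card Fq : ℝ) ^ n)⁻¹ ^ 2 := fun P hP => by
    rw [pnorm_of_monic P.2.1, (Finset.mem_filter.1 hP).2]
  rw [Finset.sum_congr rfl hterm, Finset.sum_const, nsmul_eq_mul]
  have hqn : (0 : ℝ) < (Fintype.card Fq : ℝ) ^ n := by positivity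
  calc _ ≤ (Fintype.card Fq : ℝ) ^ n * ((Fintype.card Fq : ℝ) ^ n)⁻¹ ^ 2 := by
        gcongr
        exact_mod_cast hcard
    _ = _ := by rw [inv_pow, inv_pow]; field_simp

/-- The local factor at `P` of the Dirichlet series of `d_k(m ^ 2) a_m / |m|`. -/
noncomputable def primeFactor (k : ℕ) (P : MonicPrime Fq) : ℝ⟦X⟧ :=
  PowerSeries.rescale (pnorm P.1)⁻¹ (localFactor k (pnorm P.1 + 1)⁻¹)

lemma term_ofExponents (k : ℕ) (l : MonicPrime Fq →₀ ℕ) :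
    (dfold k (ofExponents l ^ 2) : ℝ) * am (ofExponents l) / pnorm (ofExponents l) =
      l.prod fun P j => PowerSeries.coeff j (primeFactor k P) := by
  rw [dfold_sq_ofExponents, am_ofExponents, pnorm_ofExponents]
  simp only [Finsupp.prod, Nat.cast_prod]
  rw [← Finset.prod_mul_distrib, ← Finset.prod_div_distrib]
  refine Finset.prod_congr rfl fun P hP => ?_
  have h2 := P.two_le_pnorm
  rw [primeFactor, PowerSeries.coeff_rescale, coeff_localFactor,
    if_neg (Finsupp.mem_support_iff.1 hP), inv_pow]
  have : pnorm P.1 + 1 ≠ 0 := by linarith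
  field_simp
  ring

variable (Fq) in
/-- The generating series of `∑_{deg m = n} d_k(m ^ 2) a_m / |m|`. -/
noncomputable def termSeries (k : ℕ) : ℝ⟦X⟧ := PowerSeries.mk fun n =>
  ∑ᶠ m ∈ monicDeg Fq n, (dfold k (m ^ 2) : ℝ) * am m / pnorm m

lemma coeff_termSeries (k n : ℕ) : PowerSeries.coeff n (termSeries Fq k) =
    PowerSeries.coeff n (∏ P ∈ primesLE Fq n,
      PowerSeries.expand P.1.natDegree P.natDegree_ne_zero (primeFactor k P)) := by
  rw [termSeries, PowerSeries.coeff_mk]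
  refine finsum_monicDeg_eq_coeff_prod (fun P => ?_) (term_ofExponents k) n
  rw [primeFactor, PowerSeries.coeff_rescale, coeff_localFactor]
  simp

lemma coeff_mk_one_eq_coeff_prod (n : ℕ) : PowerSeries.coeff n (PowerSeries.mk 1 : ℝ⟦X⟧) =
    PowerSeries.coeff n (∏ P ∈ primesLE Fq n,
      PowerSeries.expand P.1.natDegree P.natDegree_ne_zero
        (PowerSeries.rescale (pnorm P.1)⁻¹ (PowerSeries.mk 1))) := by
  rw [← finsum_monicDeg_eq_coeff_prod (f := fun m => (pnorm m)⁻¹) (by simp) fun l => ?_]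
  · rw [finsum_mem_congr rfl fun m hm => by
      rw [pnorm_of_monic hm.1, hm.2], ← finsum_subtype_eq_finsum_cond]
    have := (finite_monicDeg (Fq := Fq) n).fintype
    rw [finsum_eq_sum_of_fintype, Finset.sum_const, Finset.card_univ, ← Nat.card_eq_fintype_card,
      card_monicDeg]
    simp
  · rw [pnorm_ofExponents, Finsupp.prod, Finsupp.prod, ← Finset.prod_inv_distrib]
    exact Finset.prod_congr rfl fun P _ => by simp [PowerSeries.coeff_rescale]

lemma mk_span_X_pow_eq_iff {n : ℕ} {F G : ℝ⟦X⟧} :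
    Ideal.Quotient.mk (Ideal.span {(PowerSeries.X : ℝ⟦X⟧) ^ (n + 1)}) F =
      Ideal.Quotient.mk (Ideal.span {(PowerSeries.X : ℝ⟦X⟧) ^ (n + 1)}) G ↔
      ∀ m ≤ n, PowerSeries.coeff m F = PowerSeries.coeff m G := by
  rw [Ideal.Quotient.mk_eq_mk_iff_sub_mem, Ideal.mem_span_singleton, PowerSeries.X_pow_dvd_iff]
  simp only [map_sub, sub_eq_zero, Nat.lt_succ_iff]

lemma mk_span_X_pow_eq_prod {F : ℝ⟦X⟧} {W : MonicPrime Fq → ℝ⟦X⟧}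
    (h0 : ∀ P, PowerSeries.constantCoeff (W P) = 1)
    (hF : ∀ n, PowerSeries.coeff n F = PowerSeries.coeff n (∏ P ∈ primesLE Fq n,
      PowerSeries.expand P.1.natDegree P.natDegree_ne_zero (W P))) (n : ℕ) :
    Ideal.Quotient.mk (Ideal.span {(PowerSeries.X : ℝ⟦X⟧) ^ (n + 1)}) F =
      Ideal.Quotient.mk (Ideal.span {(PowerSeries.X : ℝ⟦X⟧) ^ (n + 1)}) (∏ P ∈ primesLE Fq n,
        PowerSeries.expand P.1.natDegree P.natDegree_ne_zero (W P)) := by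
  rw [mk_span_X_pow_eq_iff]
  intro m hm
  rw [hF]
  exact (coeff_prod_stable mem_primesLE (fun P => by simp [h0])
    (fun P j hj hjd => coeff_expand_eq_zero_of_lt _ _ hj hjd) hm).symm

lemma coeff_termSeries_mul_pow (k n : ℕ) :
    PowerSeries.coeff n (termSeries Fq k * (1 - PowerSeries.X) ^ (k * (k + 1) / 2)) =
    PowerSeries.coeff n (∏ P ∈ primesLE Fq n,
      PowerSeries.expand P.1.natDegree P.natDegree_ne_zero
        (PowerSeries.rescale (pnorm P.1)⁻¹ (reducedFactor k (pnorm P.1 + 1)⁻¹))) := by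
  refine mk_span_X_pow_eq_iff.1 ?_ n le_rfl
  set φ := Ideal.Quotient.mk (Ideal.span {(PowerSeries.X : ℝ⟦X⟧) ^ (n + 1)})
  have hF := mk_span_X_pow_eq_prod (Fq := Fq) (F := termSeries Fq k) (W := primeFactor k)
    (fun P => by
      rw [primeFactor, ← PowerSeries.coeff_zero_eq_constantCoeff_apply,
        PowerSeries.coeff_rescale, coeff_localFactor]
      simp) (coeff_termSeries k) n
  have hZ := mk_span_X_pow_eq_prod (Fq := Fq) (fun P => by
      rw [← PowerSeries.coeff_zero_eq_constantCoeff_apply, PowerSeries.coeff_rescale]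
      simp) coeff_mk_one_eq_coeff_prod n
  set T : MonicPrime Fq → ℝ⟦X⟧ := fun P =>
    PowerSeries.expand P.1.natDegree P.natDegree_ne_zero
      (PowerSeries.rescale (pnorm P.1)⁻¹ (1 - PowerSeries.X)) with hT
  have hcancel : φ (∏ P ∈ primesLE Fq n, T P) * φ (PowerSeries.mk 1) = 1 := by
    rw [hZ, ← map_mul, ← Finset.prod_mul_distrib, Finset.prod_eq_one, map_one]
    intro P _
    rw [hT, ← map_mul, ← map_mul, mul_comm, PowerSeries.mk_one_mul_one_sub_eq_one, map_one,
      map_one]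
  have hX : φ (1 - PowerSeries.X) = φ (∏ P ∈ primesLE Fq n, T P) := by
    calc φ (1 - PowerSeries.X) = φ (∏ P ∈ primesLE Fq n, T P) *
          (φ (PowerSeries.mk 1) * φ (1 - PowerSeries.X)) := by
          rw [← mul_assoc, hcancel, one_mul]
      _ = _ := by rw [← map_mul, PowerSeries.mk_one_mul_one_sub_eq_one, map_one, mul_one]
  rw [map_mul, map_pow, hX, hF, ← map_pow, ← map_mul, ← Finset.prod_pow, ← Finset.prod_mul_distrib]
  refine congrArg φ (Finset.prod_congr rfl fun P _ => ?_)
  rw [rescale_reducedFactor, map_mul, map_pow, primeFactor]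

/-- Removing the pole of order `k (k + 1) / 2` at `1` leaves an absolutely convergent series with
nonzero sum. -/
theorem absSummable_termSeries_mul_pow {k : ℕ} (hk : 0 < k) :
    AbsSummable (termSeries Fq k * (1 - PowerSeries.X) ^ (k * (k + 1) / 2)) ∧
      coeffSum (termSeries Fq k * (1 - PowerSeries.X) ^ (k * (k + 1) / 2)) ≠ 0 := by
  obtain ⟨c, hc⟩ := exists_tsum_abs_reducedFactor_sub_one_le hk
  have hle : ∀ P : MonicPrime Fq, (pnorm P.1 + 1)⁻¹ ≤ (pnorm P.1)⁻¹ := fun P =>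
    inv_anti₀ (two_pos.trans_le P.two_le_pnorm) (by linarith)
  have hb0 : ∀ P : MonicPrime Fq, 0 ≤ (pnorm P.1 + 1)⁻¹ := fun P =>
    inv_nonneg.2 (by linarith [P.two_le_pnorm])
  refine summable_coeffSum_ne_zero_of_prod mem_primesLE (fun P => ?_)
    (fun P j hj hjd => coeff_expand_eq_zero_of_lt _ _ hj hjd)
    (fun P => (absSummable_rescale_reducedFactor hk _ P.inv_pnorm_nonneg
      P.inv_pnorm_le_half).expand _)
    (summable_inv_pnorm_sq.mul_left c) (fun P => ?_) (fun P => ?_) (coeff_termSeries_mul_pow k)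
  · rw [PowerSeries.coeff_zero_eq_constantCoeff_apply, PowerSeries.constantCoeff_expand,
      ← PowerSeries.coeff_zero_eq_constantCoeff_apply, PowerSeries.coeff_rescale]
    simp [constantCoeff_reducedFactor]
  · refine le_trans (le_of_eq ?_) (hc _ _ (hb0 P) (hle P) P.inv_pnorm_le_half)
    rw [← tsum_abs_coeff_expand (PowerSeries.rescale (pnorm P.1)⁻¹ _ - 1) P.natDegree_ne_zero,
      map_sub (PowerSeries.expand _ _), map_one]
  · rw [coeffSum_expand]
    exact coeffSum_rescale_reducedFactor_ne_zero hk
      ((hle P).trans (P.inv_pnorm_le_half.trans (by norm_num))) P.inv_pnorm_nonneg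
      P.inv_pnorm_le_half

end FiniteField

section PartialSums

open scoped PowerSeries Topology

lemma tendsto_choose_div_pow (K j : ℕ) :
    Tendsto (fun z : ℕ => ((K + (z - j)).choose K : ℝ) / (z : ℝ) ^ K) atTop
      (𝓝 ((K.factorial : ℝ)⁻¹)) := by
  have harg : Tendsto (fun z : ℕ => K + (z - j)) atTop atTop :=
    tendsto_atTop_mono (fun _ => Nat.le_add_left _ _) (tendsto_sub_atTop_nat j)
  have hpow : Tendsto (fun z : ℕ => (((K + (z - j) : ℕ) : ℝ) / z) ^ K) atTop (𝓝 (1 ^ K)) := by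
    refine Tendsto.pow ?_ K
    have h := (tendsto_const_div_atTop_nhds_zero_nat ((K : ℝ) - j)).const_add 1
    rw [add_zero] at h
    refine h.congr' ?_
    filter_upwards [eventually_ge_atTop j, eventually_gt_atTop 0] with z hz hz0
    have : (z : ℝ) ≠ 0 := by exact_mod_cast hz0.ne'
    push_cast [Nat.cast_sub hz]
    field_simp
    ring
  have h := ((isEquivalent_choose K).comp_tendsto harg).div
    (IsEquivalent.refl (u := fun z : ℕ => (z : ℝ) ^ K))
  refine h.symm.tendsto_nhds ?_
  rw [one_pow] at hpow
  have h' := hpow.mul_const ((K.factorial : ℝ)⁻¹)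
  rw [one_mul] at h'
  refine h'.congr fun z => ?_
  simp only [Function.comp_apply, Pi.div_apply, div_pow]
  ring

lemma sum_coeff_eq {B : ℝ⟦X⟧} (K z : ℕ) :
    ∑ n ∈ Finset.range (z + 1), PowerSeries.coeff n B = ∑ j ∈ Finset.range (z + 1),
      PowerSeries.coeff j (B * (1 - PowerSeries.X) ^ K) *
        ((K + (z - j)).choose K : ℝ) := by
  have hinv : (PowerSeries.mk 1 : ℝ⟦X⟧) * (1 - PowerSeries.X) = 1 :=
    PowerSeries.mk_one_mul_one_sub_eq_one ℝ
  have h : B * PowerSeries.mk 1 =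
      B * (1 - PowerSeries.X) ^ K * PowerSeries.mk 1 ^ (K + 1) := by
    calc B * PowerSeries.mk 1 = B * PowerSeries.mk 1 *
          (PowerSeries.mk 1 * (1 - PowerSeries.X)) ^ K := by rw [hinv, one_pow, mul_one]
      _ = _ := by rw [mul_pow]; ring
  have h' := congrArg (PowerSeries.coeff z) h
  rw [PowerSeries.mk_one_pow_eq_mk_choose_add, PowerSeries.coeff_mul, PowerSeries.coeff_mul,
    Finset.Nat.sum_antidiagonal_eq_sum_range_succ_mk,
    Finset.Nat.sum_antidiagonal_eq_sum_range_succ_mk] at h'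
  simpa using h'

/-- If `B (1 - X) ^ K` is absolutely convergent at `1`, the partial sums of the coefficients of `B`
grow like a constant times `z ^ K`. -/
theorem tendsto_sum_coeff_div_pow {B : ℝ⟦X⟧} {K : ℕ}
    (hG : AbsSummable (B * (1 - PowerSeries.X) ^ K)) :
    Tendsto (fun z : ℕ => (∑ n ∈ Finset.range (z + 1), PowerSeries.coeff n B) / (z : ℝ) ^ K) atTop
      (𝓝 (coeffSum (B * (1 - PowerSeries.X) ^ K) * (K.factorial : ℝ)⁻¹)) := by
  set G := B * (1 - PowerSeries.X) ^ K with hGdef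
  let t : ℕ → ℕ → ℝ := fun z j => if j ∈ Finset.range (z + 1) then
    PowerSeries.coeff j G * (((K + (z - j)).choose K : ℝ) / (z : ℝ) ^ K) else 0
  have hsum : ∀ z, ∑' j, t z j =
      (∑ n ∈ Finset.range (z + 1), PowerSeries.coeff n B) / (z : ℝ) ^ K := fun z => by
    rw [tsum_eq_sum (s := Finset.range (z + 1)) fun j hj => if_neg hj, sum_coeff_eq K,
      Finset.sum_div]
    exact Finset.sum_congr rfl fun j hj => by rw [if_pos hj, mul_div_assoc]
  rw [coeffSum, ← tsum_mul_right]
  refine Tendsto.congr hsum (tendsto_tsum_of_dominated_convergence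
    (bound := fun j => ‖PowerSeries.coeff j G‖ * ((K : ℝ) + 1) ^ K) (Summable.mul_right _ hG)
    (fun j => ?_) ?_)
  · refine ((tendsto_choose_div_pow K j).const_mul _).congr' ?_
    filter_upwards [eventually_ge_atTop j] with z hz
    exact (if_pos (Finset.mem_range.2 (Nat.lt_succ_of_le hz))).symm
  · filter_upwards [eventually_ge_atTop 1] with z hz j
    have hz0 : (0 : ℝ) < z := by exact_mod_cast hz
    by_cases hj : j ∈ Finset.range (z + 1)
    · simp only [t, if_pos hj]
      rw [norm_mul, Real.norm_of_nonneg (by positivity : (0 : ℝ) ≤ _ / (z : ℝ) ^ K)]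
      gcongr
      rw [div_le_iff₀ (by positivity), ← mul_pow]
      have hle : K + (z - j) ≤ (K + 1) * z := by
        have := Nat.le_mul_of_pos_right K hz
        linarith [Nat.sub_le z j, add_mul K 1 z]
      calc ((K + (z - j)).choose K : ℝ) ≤ ((K + (z - j)) ^ K : ℕ) := by
            exact_mod_cast Nat.choose_le_pow _ _
        _ ≤ (((K + 1) * z) ^ K : ℕ) := by exact_mod_cast Nat.pow_le_pow_left hle K
        _ = _ := by push_cast; ring
    · simp only [t, if_neg hj, norm_zero]
      positivity

end PartialSums

lemma finsum_natDegree_le_eq_sum (f : Polynomial Fq → ℝ) (z : ℕ) :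
    ∑ᶠ m ∈ {m : Polynomial Fq | m.Monic ∧ m.natDegree ≤ z}, f m =
      ∑ n ∈ Finset.range (z + 1), ∑ᶠ m ∈ monicDeg Fq n, f m := by
  have hset : {m : Polynomial Fq | m.Monic ∧ m.natDegree ≤ z} =
      ⋃ n ∈ (Finset.range (z + 1) : Set ℕ), monicDeg Fq n := by
    ext m
    simp [monicDeg, and_comm]
  rw [hset, finsum_mem_biUnion, finsum_mem_coe_finset]
  · intro a _ b _ hab
    exact Set.disjoint_left.2 fun m ha hb => hab (ha.2.symm.trans hb.2)
  · exact Finset.finite_toSet _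
  · exact fun n _ => finite_monicDeg n

lemma coeff_termSeries_nonneg (k n : ℕ) : 0 ≤ PowerSeries.coeff n (termSeries Fq k) := by
  have hp : ∀ f : Polynomial Fq, 0 ≤ pnorm f := fun f => by
    rw [pnorm]
    split_ifs <;> positivity
  have ham : ∀ f : Polynomial Fq, 0 ≤ am f := fun f =>
    finprod_nonneg fun P => finprod_nonneg fun _ => div_nonneg (hp P) (by linarith [hp P])
  rw [termSeries, PowerSeries.coeff_mk]
  exact finsum_nonneg fun m => finsum_nonneg fun _ =>
    div_nonneg (mul_nonneg (Nat.cast_nonneg _) (ham m)) (hp m)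

/-- `Σ_{deg m ≤ z} d_k(m²) a_m / |m| ∼ C(k) z^{k(k+1)/2}` as `z → ∞`. -/
theorem dk_partial_sum_asymptotic (k : ℕ) (hk : 0 < k) :
    ∃ C : ℝ, 0 < C ∧
      (fun z : ℕ => ∑ᶠ m ∈ {m : Polynomial Fq | m.Monic ∧ m.natDegree ≤ z},
          (dfold k (m ^ 2) : ℝ) * am m / pnorm m)
        ~[atTop]
      (fun z : ℕ => C * (z : ℝ) ^ (k * (k + 1) / 2)) := by
  obtain ⟨hG, hne⟩ := absSummable_termSeries_mul_pow (Fq := Fq) hk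
  have htend := tendsto_sum_coeff_div_pow hG
  set K := k * (k + 1) / 2
  set C := coeffSum (termSeries Fq k * (1 - PowerSeries.X) ^ K) * (K.factorial : ℝ)⁻¹
  have hC0 : C ≠ 0 := mul_ne_zero hne (by positivity)
  have hC : 0 ≤ C := ge_of_tendsto' htend fun z =>
    div_nonneg (Finset.sum_nonneg fun n _ => coeff_termSeries_nonneg k n) (by positivity)
  refine ⟨C, hC.lt_of_ne' hC0, ?_⟩
  have heq := ((isEquivalent_const_iff_tendsto hC0).2 htend).mul
    (IsEquivalent.refl (u := fun z : ℕ => (z : ℝ) ^ K))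
  refine heq.congr_left ?_
  filter_upwards [eventually_gt_atTop 0] with z hz
  have hzK : (z : ℝ) ^ K ≠ 0 := pow_ne_zero _ (by exact_mod_cast hz.ne')
  refine Eq.trans ?_ (finsum_natDegree_le_eq_sum _ z).symm
  rw [Pi.mul_apply, div_mul_cancel₀ _ hzK]
  simp only [termSeries, PowerSeries.coeff_mk]
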